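/- Let G be a finitely generated nilpotent group given by a finite presentation whose Dehn function satisfies δ(n) = O(n^2). Then the averaged Dehn function of that presentation satisfies δ^avg(n) = O(n log n). -/

import Mathlib

/-!
Statement 1: If `G` is a finitely generated nilpotent group given by a finite presentation
whose Dehn function satisfies `δ(n) = O(n^2)`, then the averaged Dehn function of that
presentation satisfies `δ^avg(n) = O(n log n)`.
-/

namespace AvgDehnPaper

variable {d s : ℕ}

/-- The normal closure of the relators: `R ⊆ F`. -/
def relSubgroup (r : Fin s → FreeGroup (Fin d)) : Subgroup (FreeGroup (Fin d)) :=
  Subgroup.normalClosure (Set.range r)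

instance (r : Fin s → FreeGroup (Fin d)) : (relSubgroup r).Normal :=
  Subgroup.normalClosure_normal

/-- The filling area `δ(w)` of a word `w` representing the identity: the least `k` such
that `w` is a product of `k` conjugates of relators (or their inverses) in `F`. -/
noncomputable def fillingArea (r : Fin s → FreeGroup (Fin d)) (w : FreeGroup (Fin d)) : ℕ :=
  sInf { k | ∃ (g : Fin k → FreeGroup (Fin d)) (a : Fin k → Fin s) (ε : Fin k → Bool),
    w = (List.ofFn (fun i => (g i)⁻¹ * (r (a i)) ^ (if ε i then (1 : ℤ) else -1) * g i)).prod }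

/-- The Dehn function `δ(n)`: the maximal filling area over words of length at most `n`
representing the identity. -/
noncomputable def dehn (r : Fin s → FreeGroup (Fin d)) (n : ℕ) : ℕ :=
  sSup { A | ∃ w ∈ relSubgroup r, FreeGroup.norm w ≤ n ∧ A = fillingArea r w }

/-- A lazy letter: either the identity (`none`) or a generator or its inverse. -/
abbrev Letter (d : ℕ) := Option (Fin d × Bool)

/-- The value of a lazy letter in the free group. -/
def letterVal : Letter d → FreeGroup (Fin d)
  | none => 1
  | some (i, b) => if b then FreeGroup.of i else (FreeGroup.of i)⁻¹

/-- The element of the free group spelled by the first `t` letters of a lazy word. -/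
def partialProd {n : ℕ} (w : Fin n → Letter d) (t : ℕ) : FreeGroup (Fin d) :=
  (((List.ofFn w).take t).map letterVal).prod

open scoped Classical in
/-- The (finite, nonempty) set of lazy words of length `n` representing the identity in `G`. -/
noncomputable def closedWords (r : Fin s → FreeGroup (Fin d)) (n : ℕ) :
    Finset (Fin n → Letter d) :=
  Finset.univ.filter (fun w => partialProd w n ∈ relSubgroup r)

/-- The averaged Dehn function: the average of `δ(w)` over all lazy words of length `n`
representing the identity, with respect to the uniform measure. -/
noncomputable def avgDehn (r : Fin s → FreeGroup (Fin d)) (n : ℕ) : ℝ :=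
  (∑ w ∈ closedWords r n, (fillingArea r (partialProd w n) : ℝ)) /
    ((closedWords r n).card : ℝ)

section PolynomialGrowth

open scoped Pointwise commutatorElement

theorem conj_pow_mem_pow {G : Type*} [Group G] (t : G) (y : ℕ → G)
    (hy : ∀ i, y (i + 1) = ⁅t, y i⁆) {A : Set G} (h1 : (1 : G) ∈ A) (hA : ∀ i, y i ∈ A)
    (m : ℕ) : ∀ i, y (i + m + 1) = 1 → ∀ k : ℕ, t ^ k * y i * (t ^ k)⁻¹ ∈ A ^ ((k + 1) ^ m) := by
  have hstep : ∀ i, t * y i * t⁻¹ = y (i + 1) * y i := by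
    intro i
    rw [hy, commutatorElement_def]
    group
  induction m with
  | zero =>
    intro i hi k
    have hc : t * y i * t⁻¹ = y i := by rw [hstep, hi, one_mul]
    have hcomm : Commute t (y i) := by
      exact mul_inv_eq_iff_eq_mul.mp hc
    rw [(hcomm.pow_left k).eq]
    simpa using hA i
  | succ m ih =>
    intro i hi k
    induction k with
    | zero => simpa using hA i
    | succ k ihk =>
      have e : t ^ (k + 1) * y i * (t ^ (k + 1))⁻¹
          = (t ^ k * y (i + 1) * (t ^ k)⁻¹) * (t ^ k * y i * (t ^ k)⁻¹) := by
        have : t ^ (k + 1) * y i * (t ^ (k + 1))⁻¹ = t ^ k * (t * y i * t⁻¹) * (t ^ k)⁻¹ := by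
          rw [pow_succ]; group
        rw [this, hstep]; group
      rw [e]
      have h2 := ih (i + 1) (by rw [← hi]; congr 1; omega) k
      have := Set.mul_mem_mul h2 ihk
      rw [← pow_add] at this
      refine Set.pow_subset_pow_right h1 ?_ this
      calc (k + 1) ^ m + (k + 1) ^ (m + 1) = (k + 1) ^ m * (k + 2) := by ring
        _ ≤ (k + 2) ^ m * (k + 2) := by gcongr; omega
        _ = (k + 1 + 1) ^ (m + 1) := by ring

/-- A set has polynomial growth if the cardinalities of its product sets are polynomially
bounded. -/
def PolyGrowth {G : Type*} [Group G] (A : Set G) : Prop :=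
  ∃ C D : ℕ, ∀ n : ℕ, (A ^ n).Finite ∧ (A ^ n).ncard ≤ C * (n + 1) ^ D

theorem PolyGrowth.mono {G : Type*} [Group G] {A B : Set G} (h : A ⊆ B) (hB : PolyGrowth B) :
    PolyGrowth A := by
  obtain ⟨C, D, h'⟩ := hB
  refine ⟨C, D, fun n => ⟨(h' n).1.subset (Set.pow_subset_pow_left h), ?_⟩⟩
  exact (Set.ncard_le_ncard (Set.pow_subset_pow_left h) (h' n).1).trans (h' n).2

theorem pow_insert_subset {G : Type*} [Group G] (t : G) {A B : Set G} (h1 : (1 : G) ∈ B)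
    (m : ℕ) (hAB : ∀ x ∈ A, ∀ k : ℕ, t ^ k * x * (t ^ k)⁻¹ ∈ B ^ ((k + 1) ^ m)) (n : ℕ) :
    (insert t A) ^ n ⊆
      (B ^ (n * (n + 1) ^ m)) * ((fun k : ℕ => t ^ k) '' (Set.Iio (n + 1))) := by
  have key : ∀ n N : ℕ, n ≤ N → ∀ k : ℕ, k + n ≤ N → ∀ g ∈ (insert t A) ^ n, ∃ a ≤ n,
      t ^ k * g * (t ^ (k + a))⁻¹ ∈ B ^ (n * (N + 1) ^ m) := by
    intro n N
    induction n with
    | zero =>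
      intro _ k _ g hg
      refine ⟨0, le_rfl, ?_⟩
      simp only [pow_zero, Set.mem_one] at hg
      subst hg
      simp
    | succ n ih =>
      intro hn k hk g hg
      rw [pow_succ'] at hg
      obtain ⟨s, hs, g', hg', rfl⟩ := Set.mem_mul.mp hg
      rcases hs with rfl | hs
      · obtain ⟨a, ha, h⟩ := ih (by omega) (k + 1) (by omega) g' hg'
        refine ⟨a + 1, by omega, ?_⟩
        have e : s ^ k * (s * g') * (s ^ (k + (a + 1)))⁻¹
            = s ^ (k + 1) * g' * (s ^ (k + 1 + a))⁻¹ := by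
          rw [show k + (a + 1) = k + 1 + a by ring, pow_succ s k]; group
        rw [e]
        exact Set.pow_subset_pow_right h1 (by gcongr; omega) h
      · obtain ⟨a, ha, h⟩ := ih (by omega) k (by omega) g' hg'
        refine ⟨a, by omega, ?_⟩
        have e : t ^ k * (s * g') * (t ^ (k + a))⁻¹
            = (t ^ k * s * (t ^ k)⁻¹) * (t ^ k * g' * (t ^ (k + a))⁻¹) := by group
        rw [e]
        have h2 := Set.mul_mem_mul (hAB s hs k) h
        rw [← pow_add] at h2
        refine Set.pow_subset_pow_right h1 ?_ h2
        have : (k + 1) ^ m ≤ (N + 1) ^ m := by gcongr; omega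
        nlinarith
  intro g hg
  obtain ⟨a, ha, h⟩ := key n n le_rfl 0 (by omega) g hg
  refine Set.mem_mul.mpr ⟨_, h, t ^ a, ⟨a, by simp; omega, rfl⟩, by simp⟩

theorem polyGrowth_insert {G : Type*} [Group G] (t : G) {A B : Set G} (h1 : (1 : G) ∈ B)
    (m : ℕ) (hAB : ∀ x ∈ A, ∀ k : ℕ, t ^ k * x * (t ^ k)⁻¹ ∈ B ^ ((k + 1) ^ m))
    (hB : PolyGrowth B) : PolyGrowth (insert t A) := by
  obtain ⟨C, D, h⟩ := hB
  refine ⟨C, (m + 1) * D + 1, fun n => ?_⟩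
  have hsub := pow_insert_subset t h1 m hAB n
  have hf1 := (h (n * (n + 1) ^ m)).1
  have hf2 : ((fun k : ℕ => t ^ k) '' (Set.Iio (n + 1))).Finite := (Set.finite_Iio _).image _
  have hc2 : ((fun k : ℕ => t ^ k) '' (Set.Iio (n + 1))).ncard ≤ n + 1 := by
    refine (Set.ncard_image_le (Set.finite_Iio _)).trans ?_
    simp [Set.ncard_eq_toFinset_card']
  refine ⟨(hf1.mul hf2).subset hsub, (Set.ncard_le_ncard hsub (hf1.mul hf2)).trans ?_⟩
  have hmul : ((B ^ (n * (n + 1) ^ m)) * ((fun k : ℕ => t ^ k) '' (Set.Iio (n + 1)))).ncard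
      ≤ (B ^ (n * (n + 1) ^ m)).ncard * ((fun k : ℕ => t ^ k) '' (Set.Iio (n + 1))).ncard := by
    simpa only [Nat.card_coe_set_eq] using Set.natCard_mul_le (s := B ^ (n * (n + 1) ^ m))
      (t := ((fun k : ℕ => t ^ k) '' (Set.Iio (n + 1))))
  refine hmul.trans ?_
  calc _ ≤ (C * (n * (n + 1) ^ m + 1) ^ D) * (n + 1) := Nat.mul_le_mul (h _).2 hc2
    _ ≤ (C * ((n + 1) ^ (m + 1)) ^ D) * (n + 1) := by
        gcongr
        have : 1 ≤ (n + 1) ^ m := Nat.one_le_pow _ _ (by omega)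
        rw [pow_succ]; nlinarith
    _ = C * (n + 1) ^ ((m + 1) * D + 1) := by rw [← pow_mul]; ring

/-- Finite subsets of nilpotent groups have polynomial growth. -/
theorem polyGrowth_of_isNilpotent {G : Type*} [Group G] [hG : Group.IsNilpotent G] {A : Set G}
    (hA : A.Finite) : PolyGrowth A := by
  obtain ⟨c, hc⟩ := Subgroup.nilpotent_iff_lowerCentralSeries.mp hG
  have htriv : ∀ k, ∀ x ∈ Subgroup.lowerCentralSeries (⊤ : Subgroup G) (c + k), x = 1 := by
    intro k x hx
    have := Subgroup.lowerCentralSeries_antitone (S := (⊤ : Subgroup G)) (Nat.le_add_right c k) hx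
    rw [hc] at this
    simpa using this
  suffices H : ∀ e j : ℕ, c ≤ j + e → ∀ A B : Set G, A.Finite → B.Finite →
      A ⊆ Subgroup.lowerCentralSeries (⊤ : Subgroup G) j →
      B ⊆ Subgroup.lowerCentralSeries (⊤ : Subgroup G) (j + 1) → PolyGrowth (A ∪ B) by
    simpa using H c 0 (by omega) A ∅ hA Set.finite_empty (by simp) (by simp)
  intro e
  induction e with
  | zero =>
    intro j hj A B _ _ hAj hBj
    have hsub : A ∪ B ⊆ {1} := by
      rintro x (hx | hx)
      · exact htriv (j - c) x (by rw [Nat.add_sub_cancel' (by omega)]; exact hAj hx)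
      · exact htriv (j + 1 - c) x (by rw [Nat.add_sub_cancel' (by omega)]; exact hBj hx)
    refine PolyGrowth.mono hsub ⟨1, 0, fun n => ?_⟩
    simp
  | succ e ih =>
    intro j hj A B hAf hBf hAj hBj
    induction A, hAf using Set.Finite.induction_on generalizing B with
    | empty =>
      simpa using ih (j + 1) (by omega) B ∅ hBf Set.finite_empty hBj (by simp)
    | @insert t A htA hAf ihA =>
      have hAj' : A ⊆ Subgroup.lowerCentralSeries (⊤ : Subgroup G) j :=
        (Set.subset_insert _ _).trans hAj
      let y : G → ℕ → G := fun x i => (fun z => ⁅t, z⁆)^[i] x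
      have hy : ∀ x i, y x (i + 1) = ⁅t, y x i⁆ := fun x i => by
        simp only [y, Function.iterate_succ_apply']
      have hymem : ∀ x ∈ A ∪ B, ∀ i,
          y x i ∈ Subgroup.lowerCentralSeries (⊤ : Subgroup G) (j + i) := by
        intro x hx i
        induction i with
        | zero =>
          rcases hx with hx | hx
          · exact hAj' hx
          · exact Subgroup.lowerCentralSeries_antitone _ (Nat.le_succ j) (hBj hx)
        | succ i ihi =>
          rw [hy, ← commutatorElement_inv]
          exact inv_mem (Subgroup.commutator_mem_commutator ihi (Subgroup.mem_top t))
      let B' : Set G := insert 1 (B ∪ ⋃ i ∈ Set.Iio (c + 1), (fun x => y x (i + 1)) '' (A ∪ B))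
      have hB'f : B'.Finite := by
        refine Set.Finite.insert _ (hBf.union ?_)
        exact Set.Finite.biUnion (Set.finite_Iio _) fun i _ => (hAf.union hBf).image _
      have hB'j : B' ⊆ Subgroup.lowerCentralSeries (⊤ : Subgroup G) (j + 1) := by
        rintro x (rfl | hx | hx)
        · exact one_mem _
        · exact hBj hx
        · simp only [Set.mem_iUnion] at hx
          obtain ⟨i, _, z, hz, rfl⟩ := hx
          exact Subgroup.lowerCentralSeries_antitone _ (by omega : j + 1 ≤ j + (i + 1))
            (hymem z hz (i + 1))
      have hg := ihA B' hB'f hAj' hB'j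
      rw [Set.insert_union]
      refine polyGrowth_insert t (B := A ∪ B') (Or.inr (Or.inl rfl)) c ?_ hg
      intro x hx k
      have hyone : ∀ i, c ≤ i → y x i = 1 := fun i hi =>
        htriv (j + i - c) _ (by rw [Nat.add_sub_cancel' (by omega)]; exact hymem x hx i)
      refine conj_pow_mem_pow t (y x) (hy x) (Or.inr (Or.inl rfl)) ?_ c 0
        (hyone (0 + c + 1) (by omega)) k
      intro i
      rcases i with _ | i
      · rcases hx with hx | hx
        · exact Or.inl hx
        · exact Or.inr (Or.inr (Or.inl hx))
      · by_cases hi : i < c + 1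
        · refine Or.inr (Or.inr (Or.inr ?_))
          simp only [Set.mem_iUnion]
          exact ⟨i, hi, x, hx, rfl⟩
        · rw [hyone _ (by omega)]
          exact Or.inr (Or.inl rfl)

/-- The operator summing a function on a group over all right translates by the letters. -/
noncomputable def walkOp {G L : Type*} [Group G] [Fintype L] (φ : L → G) :
    Module.End ℝ (G → ℝ) where
  toFun f x := ∑ l, f (x * φ l)
  map_add' f g := by ext x; simp [Finset.sum_add_distrib]
  map_smul' c f := by ext x; simp [Finset.mul_sum]

theorem walkOp_apply {G L : Type*} [Group G] [Fintype L] (φ : L → G) (f : G → ℝ) (x : G) :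
    walkOp φ f x = ∑ l, f (x * φ l) := rfl

/-- `walkCount φ k x` is the number of words of length `k` that lead from `x` to `1`. -/
noncomputable def walkCount {G L : Type*} [Group G] [Fintype L] (φ : L → G) (k : ℕ) : G → ℝ :=
  (walkOp φ ^ k) (({1} : Set G).indicator 1)

/-- The sum of `f` over the values of all words of length `k`. -/
noncomputable def walkSum {G L : Type*} [Group G] [Fintype L] (φ : L → G) (k : ℕ) (f : G → ℝ) :
    ℝ :=
  (walkOp φ ^ k) f 1

section Walk

variable {G L : Type*} [Group G] [Fintype L] (φ : L → G)

theorem walkCount_zero (x : G) : walkCount φ 0 x = ({1} : Set G).indicator 1 x := rfl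

theorem walkCount_succ (k : ℕ) (x : G) :
    walkCount φ (k + 1) x = ∑ l, walkCount φ k (x * φ l) := by
  rw [walkCount, pow_succ']; rfl

theorem walkSum_succ (k : ℕ) (f : G → ℝ) :
    walkSum φ (k + 1) f = walkSum φ k (walkOp φ f) := by
  rw [walkSum, pow_succ]; rfl

theorem walkSum_walkCount (j k : ℕ) : walkSum φ j (walkCount φ k) = walkCount φ (j + k) 1 := by
  rw [walkSum, walkCount, walkCount, pow_add]; rfl

theorem walkOp_mono {f g : G → ℝ} (h : f ≤ g) : walkOp φ f ≤ walkOp φ g :=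
  fun _ => Finset.sum_le_sum fun _ _ => h _

theorem walkOp_pow_mono (k : ℕ) {f g : G → ℝ} (h : f ≤ g) :
    (walkOp φ ^ k) f ≤ (walkOp φ ^ k) g := by
  induction k generalizing f g with
  | zero => simpa using h
  | succ k ih => rw [pow_succ]; exact ih (walkOp_mono φ h)

theorem walkSum_mono (k : ℕ) {f g : G → ℝ} (h : ∀ x, f x ≤ g x) : walkSum φ k f ≤ walkSum φ k g :=
  walkOp_pow_mono φ k h 1

theorem walkSum_add (k : ℕ) (f g : G → ℝ) :
    walkSum φ k (fun x => f x + g x) = walkSum φ k f + walkSum φ k g := by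
  simp only [walkSum]
  exact congrFun (map_add (walkOp φ ^ k) f g) 1

theorem walkSum_sub (k : ℕ) (f g : G → ℝ) :
    walkSum φ k (fun x => f x - g x) = walkSum φ k f - walkSum φ k g := by
  simp only [walkSum]
  exact congrFun (map_sub (walkOp φ ^ k) f g) 1

theorem walkSum_const_mul (k : ℕ) (c : ℝ) (f : G → ℝ) :
    walkSum φ k (fun x => c * f x) = c * walkSum φ k f := by
  simp only [walkSum]
  exact congrFun (map_smul (walkOp φ ^ k) c f) 1

theorem walkSum_zero_fun (k : ℕ) : walkSum φ k (fun _ => 0) = 0 := by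
  simp only [walkSum]
  exact congrFun (map_zero (walkOp φ ^ k)) 1

theorem walkSum_one (k : ℕ) : walkSum φ k (fun _ => 1) = (Fintype.card L : ℝ) ^ k := by
  induction k with
  | zero => simp [walkSum]
  | succ k ih =>
    have : walkOp φ (fun _ => 1) = fun _ : G => (Fintype.card L : ℝ) * 1 := by
      ext x; simp [walkOp_apply]
    rw [walkSum_succ, this, walkSum_const_mul, ih, pow_succ']

theorem walkCount_nonneg (k : ℕ) (x : G) : 0 ≤ walkCount φ k x := by
  induction k generalizing x with
  | zero => exact Set.indicator_nonneg (fun _ _ => zero_le_one) _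
  | succ k ih => rw [walkCount_succ]; exact Finset.sum_nonneg fun _ _ => ih _

theorem walkCount_mul_le (k : ℕ) (x : G) (l : L) :
    walkCount φ k (x * φ l) ≤ walkCount φ (k + 1) x := by
  rw [walkCount_succ]
  exact Finset.single_le_sum (f := fun l => walkCount φ k (x * φ l))
    (fun _ _ => walkCount_nonneg φ k _) (Finset.mem_univ l)

theorem walkCount_support_finite (k : ℕ) : (walkCount φ k).support.Finite := by
  induction k with
  | zero =>
    refine (Set.finite_singleton (1 : G)).subset ?_
    exact Set.support_indicator_subset
  | succ k ih =>
    refine (Set.finite_iUnion fun l => ih.image (fun x => x * (φ l)⁻¹)).subset ?_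
    intro x hx
    rw [Function.mem_support, walkCount_succ] at hx
    obtain ⟨l, _, hl⟩ := Finset.exists_ne_zero_of_sum_ne_zero hx
    exact Set.mem_iUnion.mpr ⟨l, x * φ l, hl, by simp⟩

/-- The walk operator is symmetric when the letters are closed under inversion. -/
theorem finsum_walkOp_mul (ι : L ≃ L) (hι : ∀ l, φ (ι l) = (φ l)⁻¹) (f h : G → ℝ)
    (hh : h.support.Finite) :
    ∑ᶠ x, walkOp φ f x * h x = ∑ᶠ x, f x * walkOp φ h x := by
  have h1 : ∀ x, walkOp φ f x * h x = ∑ l, f (x * φ l) * h x := fun x => by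
    rw [walkOp_apply, Finset.sum_mul]
  have h2 : ∀ x, f x * walkOp φ h x = ∑ l, f x * h (x * φ l) := fun x => by
    rw [walkOp_apply, Finset.mul_sum]
  simp_rw [h1, h2]
  rw [finsum_sum_comm, finsum_sum_comm]
  · rw [← Equiv.sum_comp ι]
    refine Finset.sum_congr rfl fun l _ => ?_
    rw [← finsum_comp_equiv (Equiv.mulRight (φ l))]
    simp [hι]
  · intro l _
    refine (hh.preimage ((mul_left_injective (φ l)).injOn)).subset ?_
    intro x hx
    exact right_ne_zero_of_mul hx
  · intro l _
    refine hh.subset ?_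
    intro x hx
    exact right_ne_zero_of_mul hx

theorem walkSum_eq_finsum (ι : L ≃ L) (hι : ∀ l, φ (ι l) = (φ l)⁻¹) (k : ℕ) (f : G → ℝ) :
    walkSum φ k f = ∑ᶠ x, f x * walkCount φ k x := by
  induction k generalizing f with
  | zero =>
    rw [finsum_eq_single _ (1 : G)]
    · simp [walkSum, walkCount_zero]
    · intro x hx
      simp [walkCount_zero, hx]
  | succ k ih =>
    rw [walkSum_succ, ih, finsum_walkOp_mul φ ι hι _ _ (walkCount_support_finite φ k)]
    simp_rw [walkCount_succ, walkOp_apply]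

theorem walkSum_mul_walkCount_comm (ι : L ≃ L) (hι : ∀ l, φ (ι l) = (φ l)⁻¹) (j k : ℕ)
    (f : G → ℝ) :
    walkSum φ j (fun x => f x * walkCount φ k x) =
      walkSum φ k (fun x => f x * walkCount φ j x) := by
  rw [walkSum_eq_finsum φ ι hι, walkSum_eq_finsum φ ι hι]
  refine finsum_congr fun x => ?_
  ring

end Walk

theorem walkCount_support_subset_pow {G L : Type*} [Group G] [Fintype L] (φ : L → G) (k : ℕ) :
    (walkCount φ k).support ⊆ (Set.range fun l => (φ l)⁻¹) ^ k := by
  induction k with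
  | zero => rw [pow_zero]; exact Set.support_indicator_subset
  | succ k ih =>
    intro x hx
    rw [Function.mem_support, walkCount_succ] at hx
    obtain ⟨l, _, hl⟩ := Finset.exists_ne_zero_of_sum_ne_zero hx
    rw [pow_succ]
    exact Set.mem_mul.mpr ⟨_, ih hl, (φ l)⁻¹, ⟨l, rfl⟩, by simp⟩

/-- The return probability of a symmetric lazy random walk on a group of polynomial growth is at
least an inverse polynomial. -/
theorem card_pow_le_walkCount {G L : Type*} [Group G] [Fintype L] (φ : L → G)
    (ι : L ≃ L) (hι : ∀ l, φ (ι l) = (φ l)⁻¹) (l₀ : L) (hl₀ : φ l₀ = 1)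
    (hG : PolyGrowth (Set.range fun l => (φ l)⁻¹)) :
    ∃ C D : ℕ, 0 < C ∧ ∀ n : ℕ,
      (Fintype.card L : ℝ) ^ n ≤ C * ((n : ℝ) + 1) ^ D * walkCount φ n 1 := by
  obtain ⟨C, D, h⟩ := hG
  have heven : ∀ k : ℕ, (Fintype.card L : ℝ) ^ (k + k) ≤
      C * ((k : ℝ) + 1) ^ D * walkCount φ (k + k) 1 := by
    intro k
    have hfin := walkCount_support_finite φ k
    have hcard : (hfin.toFinset.card : ℝ) ≤ C * ((k : ℝ) + 1) ^ D := by
      have h1 := Set.ncard_le_ncard (walkCount_support_subset_pow φ k) (h k).1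
      rw [Set.ncard_eq_toFinset_card _ hfin] at h1
      exact_mod_cast h1.trans (h k).2
    have h1 : (Fintype.card L : ℝ) ^ k = ∑ x ∈ hfin.toFinset, walkCount φ k x := by
      rw [← walkSum_one (G := G) φ k, walkSum_eq_finsum φ ι hι]
      simp only [one_mul]
      exact finsum_eq_sum_of_support_subset _ (by simp)
    have h2 : walkCount φ (k + k) 1 = ∑ x ∈ hfin.toFinset, walkCount φ k x ^ 2 := by
      rw [← walkSum_walkCount, walkSum_eq_finsum φ ι hι]
      simp only [← sq]
      refine finsum_eq_sum_of_support_subset _ ?_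
      intro x hx
      simpa using hx
    calc (Fintype.card L : ℝ) ^ (k + k) = (∑ x ∈ hfin.toFinset, walkCount φ k x) ^ 2 := by
          rw [← h1]; ring
      _ ≤ hfin.toFinset.card * ∑ x ∈ hfin.toFinset, walkCount φ k x ^ 2 :=
          sq_sum_le_card_mul_sum_sq
      _ ≤ _ := by
          rw [← h2]
          exact mul_le_mul_of_nonneg_right hcard (walkCount_nonneg φ _ _)
  have hN : (1 : ℝ) ≤ Fintype.card L := by
    exact_mod_cast Fintype.card_pos_iff.mpr ⟨l₀⟩
  refine ⟨(C + 1) * Fintype.card L, D, ?_, fun n => ?_⟩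
  · exact Nat.mul_pos (Nat.succ_pos _) (Fintype.card_pos_iff.mpr ⟨l₀⟩)
  have hC : (0 : ℝ) ≤ C := Nat.cast_nonneg C
  rcases Nat.even_or_odd' n with ⟨k, rfl | rfl⟩
  · rw [two_mul]
    refine (heven k).trans ?_
    refine mul_le_mul_of_nonneg_right ?_ (walkCount_nonneg φ _ _)
    push_cast
    have : ((k : ℝ) + 1) ^ D ≤ ((k : ℝ) + k + 1) ^ D := by
      have : (0 : ℝ) ≤ k := Nat.cast_nonneg k
      gcongr; linarith
    gcongr
    nlinarith
  · have h1 : walkCount φ (k + k) 1 ≤ walkCount φ (2 * k + 1) 1 := by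
      have := walkCount_mul_le φ (k + k) 1 l₀
      rwa [hl₀, mul_one, show k + k + 1 = 2 * k + 1 by ring] at this
    calc (Fintype.card L : ℝ) ^ (2 * k + 1)
        = Fintype.card L * (Fintype.card L : ℝ) ^ (k + k) := by ring
      _ ≤ Fintype.card L * (C * ((k : ℝ) + 1) ^ D * walkCount φ (k + k) 1) := by
          gcongr; exact heven k
      _ ≤ Fintype.card L * ((C + 1) * (((2 * k + 1 : ℕ) : ℝ) + 1) ^ D
            * walkCount φ (2 * k + 1) 1) := by
          have : (0 : ℝ) ≤ k := Nat.cast_nonneg k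
          have := walkCount_nonneg φ (k + k) 1
          gcongr
          · linarith
          · linarith
      _ = _ := by push_cast; ring

end PolynomialGrowth

/-- A pointwise form of Pinsker's inequality. -/
theorem mul_sub_le_sq_add_log {p q F a t : ℝ} (hp : 0 ≤ p) (hq : 0 ≤ q) (hqp : q = 0 → p = 0)
    (hF : |F| ≤ a) (ht : 0 < t) :
    F * (p - q) ≤ t⁻¹ * (a ^ 2 * (p + q) / 2) + t * (p * Real.log (p / q) - p + q) := by
  rcases hq.eq_or_lt with h0 | hq'
  · rw [hqp h0.symm, ← h0]; simp
  have ha : F ^ 2 ≤ a ^ 2 := sq_le_sq' (by linarith [abs_le.mp hF]) (abs_le.mp hF).2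
  have hkl : (√p - √q) ^ 2 ≤ p * Real.log (p / q) - p + q := by
    rcases hp.eq_or_lt with h0 | hp'
    · rw [← h0]; simp [Real.sq_sqrt hq]
    have hsp := Real.sqrt_pos.mpr hp'
    have hsq := Real.sqrt_pos.mpr hq'
    have h1 : Real.log (p / q) = -2 * Real.log (√q / √p) := by
      rw [← Real.sqrt_div hq, Real.log_sqrt (div_nonneg hq hp), ← inv_div p q, Real.log_inv]
      ring
    have h2 := Real.log_le_sub_one_of_pos (div_pos hsq hsp)
    have h3 : p * (√q / √p) = √p * √q := by
      rw [mul_div_assoc', div_eq_iff hsp.ne']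
      nlinarith [Real.mul_self_sqrt hp]
    have h4 : (√p - √q) ^ 2 = p - 2 * (√p * √q) + q := by
      nlinarith [Real.mul_self_sqrt hp, Real.mul_self_sqrt hq]
    rw [h4, h1]
    nlinarith
  have hpq : (p - q) ^ 2 ≤ 2 * (p + q) * (√p - √q) ^ 2 := by
    have h1 : p - q = (√p - √q) * (√p + √q) := by
      nlinarith [Real.mul_self_sqrt hp, Real.mul_self_sqrt hq]
    have h2 : (√p + √q) ^ 2 ≤ 2 * (p + q) := by
      nlinarith [Real.mul_self_sqrt hp, Real.mul_self_sqrt hq, sq_nonneg (√p - √q)]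
    rw [h1, mul_pow]
    nlinarith [sq_nonneg (√p - √q)]
  have hs : 0 < p + q := by linarith
  have h5 : F * (p - q) ≤ t⁻¹ * (F ^ 2 * (p + q) / 2) + t * ((p - q) ^ 2 / (2 * (p + q))) := by
    have h6 : t⁻¹ * (F ^ 2 * (p + q) / 2) + t * ((p - q) ^ 2 / (2 * (p + q))) - F * (p - q)
        = (F * (p + q) - t * (p - q)) ^ 2 / (2 * t * (p + q)) := by
      field_simp
      ring
    have : 0 ≤ (F * (p + q) - t * (p - q)) ^ 2 / (2 * t * (p + q)) := by positivity
    linarith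
  have h7 : (p - q) ^ 2 / (2 * (p + q)) ≤ p * Real.log (p / q) - p + q := by
    refine le_trans ?_ hkl
    rw [div_le_iff₀ (by linarith)]
    linarith
  calc F * (p - q) ≤ _ := h5
    _ ≤ _ := by gcongr

/-- The sum, over all closed words of length `m + k` based at `1`, of `f` at time `m`. -/
noncomputable def bridgeSum {G L : Type*} [Group G] [Fintype L] (φ : L → G) (m k : ℕ)
    (f : G → ℝ) : ℝ :=
  walkSum φ m fun x => f x * walkCount φ k x

/-- The relative entropy of the letter following time `m` in a closed word of length `m + k + 1`,
with respect to the uniform distribution and conditionally on the position at time `m`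
(multiplied by the number of closed words). -/
noncomputable def bridgeEntropy {G L : Type*} [Group G] [Fintype L] (φ : L → G) (m k : ℕ) : ℝ :=
  walkSum φ m fun x => ∑ l, walkCount φ k (x * φ l) *
    Real.log (walkCount φ k (x * φ l) / (walkCount φ (k + 1) x / Fintype.card L))

section Bridge

variable {G L : Type*} [Group G] [Fintype L] (φ : L → G)

theorem bridgeSum_add (m k : ℕ) (f g : G → ℝ) :
    bridgeSum φ m k (fun x => f x + g x) = bridgeSum φ m k f + bridgeSum φ m k g := by
  simp only [bridgeSum, add_mul, walkSum_add]

theorem bridgeSum_const_mul (m k : ℕ) (c : ℝ) (f : G → ℝ) :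
    bridgeSum φ m k (fun x => c * f x) = c * bridgeSum φ m k f := by
  simp only [bridgeSum, mul_assoc, walkSum_const_mul]

theorem bridgeSum_one (m k : ℕ) : bridgeSum φ m k (fun _ => 1) = walkCount φ (m + k) 1 := by
  simp only [bridgeSum, one_mul]
  exact walkSum_walkCount φ m k

theorem bridgeSum_mono (m k : ℕ) {f g : G → ℝ} (h : ∀ x, f x ≤ g x) :
    bridgeSum φ m k f ≤ bridgeSum φ m k g :=
  walkSum_mono φ m fun x => mul_le_mul_of_nonneg_right (h x) (walkCount_nonneg φ k x)

theorem bridgeSum_succ (m k : ℕ) (f : G → ℝ) :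
    bridgeSum φ (m + 1) k f =
      walkSum φ m fun x => ∑ l, f (x * φ l) * walkCount φ k (x * φ l) :=
  walkSum_succ φ m _

variable [Nonempty L]

theorem sum_walkCount_div_card (k : ℕ) (x : G) :
    ∑ _l : L, walkCount φ (k + 1) x / Fintype.card L = walkCount φ (k + 1) x := by
  have : (Fintype.card L : ℝ) ≠ 0 := by exact_mod_cast Fintype.card_ne_zero
  rw [Finset.sum_const, Finset.card_univ, nsmul_eq_mul]
  field_simp

theorem walkCount_eq_zero_of_uniform (k : ℕ) (x : G) (l : L)
    (h : walkCount φ (k + 1) x / Fintype.card L = 0) : walkCount φ k (x * φ l) = 0 := by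
  have hN : (Fintype.card L : ℝ) ≠ 0 := by exact_mod_cast Fintype.card_ne_zero
  have h1 : walkCount φ (k + 1) x = 0 := by simpa [hN] using h
  exact le_antisymm (h1 ▸ walkCount_mul_le φ k x l) (walkCount_nonneg φ _ _)

theorem bridge_step_le (m k : ℕ) (F : G → L → ℝ) (a : G → ℝ) (hF : ∀ x l, |F x l| ≤ a x)
    {t : ℝ} (ht : 0 < t) :
    walkSum φ m (fun x => ∑ l, F x l *
        (walkCount φ k (x * φ l) - walkCount φ (k + 1) x / Fintype.card L)) ≤
      t⁻¹ * bridgeSum φ m (k + 1) (fun x => a x ^ 2) + t * bridgeEntropy φ m k := by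
  rw [bridgeSum, bridgeEntropy, ← walkSum_const_mul, ← walkSum_const_mul, ← walkSum_add]
  refine walkSum_mono φ m fun x => ?_
  have h1 : ∀ l, F x l * (walkCount φ k (x * φ l) - walkCount φ (k + 1) x / Fintype.card L) ≤ _ :=
    fun l => mul_sub_le_sq_add_log (walkCount_nonneg φ k (x * φ l))
      (div_nonneg (walkCount_nonneg φ (k + 1) x) (Nat.cast_nonneg (Fintype.card L)))
      (walkCount_eq_zero_of_uniform φ k x l) (hF x l) ht
  refine (Finset.sum_le_sum fun l _ => h1 l).trans (le_of_eq ?_)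
  have h2 := sum_walkCount_div_card φ k x
  have h3 := (walkCount_succ φ k x).symm
  rw [Finset.sum_add_distrib, ← Finset.mul_sum, ← Finset.mul_sum, Finset.sum_add_distrib,
    Finset.sum_sub_distrib, h2, h3, ← Finset.sum_div, ← Finset.mul_sum, Finset.sum_add_distrib,
    h2, h3]
  ring

theorem bridgeEntropy_nonneg (m k : ℕ) : 0 ≤ bridgeEntropy φ m k := by
  have h := bridge_step_le φ m k (fun _ _ => 0) (fun _ => 0) (by simp) one_pos
  simpa [bridgeSum, walkSum_zero_fun] using h

theorem bridgeEntropy_eq (m k : ℕ) :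
    bridgeEntropy φ m k = walkCount φ (m + (k + 1)) 1 * Real.log (Fintype.card L)
      + (walkSum φ (m + 1) (fun x => walkCount φ k x * Real.log (walkCount φ k x))
      - walkSum φ m (fun x => walkCount φ (k + 1) x * Real.log (walkCount φ (k + 1) x))) := by
  have hN : (Fintype.card L : ℝ) ≠ 0 := by exact_mod_cast Fintype.card_ne_zero
  rw [bridgeEntropy, walkSum_succ, ← walkSum_walkCount, ← walkSum_sub, mul_comm,
    ← walkSum_const_mul, ← walkSum_add]
  congr 1
  ext x
  rw [walkOp_apply, walkCount_succ, Finset.mul_sum, Finset.sum_mul, ← Finset.sum_sub_distrib,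
    ← Finset.sum_add_distrib]
  refine Finset.sum_congr rfl fun l _ => ?_
  rw [← walkCount_succ]
  by_cases h : walkCount φ k (x * φ l) = 0
  · simp [h]
  have h' : walkCount φ (k + 1) x ≠ 0 := fun h0 =>
    h (walkCount_eq_zero_of_uniform φ k x l (by simp [h0]))
  rw [Real.log_div h (div_ne_zero h' hN), Real.log_div h' hN]
  ring

/-- The relative entropies of the letters of a random closed word add up to the logarithm of the
inverse return probability. -/
theorem sum_bridgeEntropy (n : ℕ) :
    ∑ m ∈ Finset.range n, bridgeEntropy φ m (n - 1 - m) =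
      walkCount φ n 1 * (n * Real.log (Fintype.card L) - Real.log (walkCount φ n 1)) := by
  let a : ℕ → ℝ := fun m =>
    walkSum φ m (fun x => walkCount φ (n - m) x * Real.log (walkCount φ (n - m) x))
  have h : ∀ m ∈ Finset.range n, bridgeEntropy φ m (n - 1 - m) =
      walkCount φ n 1 * Real.log (Fintype.card L) + (a (m + 1) - a m) := by
    intro m hm
    have hm := Finset.mem_range.mp hm
    rw [bridgeEntropy_eq, show m + (n - 1 - m + 1) = n by omega]
    simp only [a]
    rw [show n - 1 - m + 1 = n - m by omega, show n - (m + 1) = n - 1 - m by omega]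
  rw [Finset.sum_congr rfl h, Finset.sum_add_distrib, Finset.sum_range_sub]
  have h0 : a 0 = walkCount φ n 1 * Real.log (walkCount φ n 1) := by
    simp [a, walkSum]
  have hn : a n = 0 := by
    have : (fun x : G => walkCount φ (n - n) x * Real.log (walkCount φ (n - n) x)) =
        fun _ => 0 := by
      ext x
      rw [Nat.sub_self, walkCount_zero]
      by_cases hx : x = 1 <;> simp [hx]
    simp only [a, this, walkSum_zero_fun]
  rw [h0, hn]
  simp
  ring

theorem abs_bridge_step_le {len : G → ℝ} (h0 : ∀ x, 0 ≤ len x)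
    (hlen : ∀ x l, |len (x * φ l) - len x| ≤ 1) (m k : ℕ) {t : ℝ} (ht : 0 < t) :
    |bridgeSum φ (m + 1) k (fun x => len x ^ 2) -
        bridgeSum φ m (k + 1) (fun x => (∑ l, len (x * φ l) ^ 2) / Fintype.card L)| ≤
      t⁻¹ * (8 * bridgeSum φ m (k + 1) (fun x => len x ^ 2) + 2 * walkCount φ (m + (k + 1)) 1)
        + t * bridgeEntropy φ m k := by
  have hF : ∀ x l, |len (x * φ l) ^ 2 - len x ^ 2| ≤ 2 * len x + 1 := by
    intro x l
    have h1 := abs_le.mp (hlen x l)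
    have h2 := h0 x
    have h3 := h0 (x * φ l)
    rw [abs_le]
    constructor <;> nlinarith
  have hsq : bridgeSum φ m (k + 1) (fun x => (2 * len x + 1) ^ 2) ≤
      8 * bridgeSum φ m (k + 1) (fun x => len x ^ 2) + 2 * walkCount φ (m + (k + 1)) 1 := by
    rw [← bridgeSum_one φ m (k + 1), ← bridgeSum_const_mul, ← bridgeSum_const_mul,
      ← bridgeSum_add]
    refine bridgeSum_mono φ _ _ fun x => ?_
    nlinarith [sq_nonneg (2 * len x - 1)]
  have heq : bridgeSum φ (m + 1) k (fun x => len x ^ 2) -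
        bridgeSum φ m (k + 1) (fun x => (∑ l, len (x * φ l) ^ 2) / Fintype.card L) =
      walkSum φ m (fun x => ∑ l, (len (x * φ l) ^ 2 - len x ^ 2) *
        (walkCount φ k (x * φ l) - walkCount φ (k + 1) x / Fintype.card L)) := by
    rw [bridgeSum_succ, bridgeSum, ← walkSum_sub]
    congr 1
    ext x
    have h2 := sum_walkCount_div_card φ k x
    have h3 := (walkCount_succ φ k x).symm
    simp only [sub_mul, mul_sub]
    rw [Finset.sum_sub_distrib, Finset.sum_sub_distrib, Finset.sum_sub_distrib, ← Finset.mul_sum,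
      ← Finset.mul_sum, h2, h3, ← Finset.sum_mul]
    ring
  have key1 := bridge_step_le φ m k (fun x l => len (x * φ l) ^ 2 - len x ^ 2)
    (fun x => 2 * len x + 1) hF ht
  have key2 := bridge_step_le φ m k (fun x l => -(len (x * φ l) ^ 2 - len x ^ 2))
    (fun x => 2 * len x + 1) (fun x l => by rw [abs_neg]; exact hF x l) ht
  have hneg : walkSum φ m (fun x => ∑ l, -(len (x * φ l) ^ 2 - len x ^ 2) *
        (walkCount φ k (x * φ l) - walkCount φ (k + 1) x / Fintype.card L)) =
      -walkSum φ m (fun x => ∑ l, (len (x * φ l) ^ 2 - len x ^ 2) *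
        (walkCount φ k (x * φ l) - walkCount φ (k + 1) x / Fintype.card L)) := by
    rw [neg_eq_neg_one_mul, ← walkSum_const_mul]
    simp only [neg_mul, Finset.sum_neg_distrib, one_mul]
  rw [hneg, ← heq] at key2
  rw [← heq] at key1
  have hmul := mul_le_mul_of_nonneg_left hsq (inv_nonneg.mpr ht.le)
  rw [abs_le]
  constructor <;> linarith

theorem bridgeSum_sq_le_add {len : G → ℝ} (h0 : ∀ x, 0 ≤ len x)
    (hlen : ∀ x l, |len (x * φ l) - len x| ≤ 1)
    (ι : L ≃ L) (hι : ∀ l, φ (ι l) = (φ l)⁻¹) {n m : ℕ} (hm : 1 ≤ m) (hmn : m < n)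
    {t : ℝ} (ht : 0 < t) :
    bridgeSum φ (m + 1) (n - (m + 1)) (fun x => len x ^ 2) ≤
      bridgeSum φ (m - 1) (n - (m - 1)) (fun x => len x ^ 2)
      + t⁻¹ * (16 * bridgeSum φ m (n - m) (fun x => len x ^ 2) + 4 * walkCount φ n 1)
      + t * (bridgeEntropy φ m (n - 1 - m) + bridgeEntropy φ (n - m) (n - 1 - (n - m))) := by
  have h1 := (abs_le.mp (abs_bridge_step_le φ h0 hlen m (n - 1 - m) ht)).2
  rw [show n - 1 - m + 1 = n - m by omega, show m + (n - m) = n by omega] at h1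
  have h2 := (abs_le.mp (abs_bridge_step_le φ h0 hlen (n - m) (n - 1 - (n - m)) ht)).1
  rw [show n - 1 - (n - m) + 1 = m by omega, show n - m + m = n by omega,
    show n - 1 - (n - m) = m - 1 by omega, show n - m + 1 = n - (m - 1) by omega] at h2
  have hc : ∀ (j k : ℕ) (f : G → ℝ), bridgeSum φ j k f = bridgeSum φ k j f :=
    fun j k f => walkSum_mul_walkCount_comm φ ι hι j k f
  rw [hc (n - (m - 1)), hc (n - m), hc (n - m)] at h2
  rw [show n - 1 - m = n - (m + 1) by omega] at h1
  rw [show n - 1 - m = n - (m + 1) by omega, show n - 1 - (n - m) = m - 1 by omega]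
  linarith

end Bridge

theorem sum_inv_sqrt_le (m : ℕ) : ∑ l ∈ Finset.Ico 1 (m + 1), (√(l : ℝ))⁻¹ ≤ 2 * √(m : ℝ) := by
  induction m with
  | zero => simp
  | succ m ih =>
    rw [Finset.sum_Ico_succ_top (by omega)]
    have h1 : (0 : ℝ) < √((m + 1 : ℕ) : ℝ) := Real.sqrt_pos.mpr (by positivity)
    have h2 : (√((m + 1 : ℕ) : ℝ))⁻¹ ≤ 2 * √((m + 1 : ℕ) : ℝ) - 2 * √(m : ℝ) := by
      rw [inv_le_iff_one_le_mul₀ h1]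
      have h3 := Real.mul_self_sqrt (Nat.cast_nonneg (α := ℝ) (m + 1))
      have h4 := Real.mul_self_sqrt (Nat.cast_nonneg (α := ℝ) m)
      push_cast at *
      nlinarith [sq_nonneg (√((m : ℝ) + 1) - √(m : ℝ))]
    linarith

/-- A discrete Gronwall inequality with step parameters of order `√(r * l)`. -/
theorem le_of_two_step_recursion {M I : ℕ → ℝ} {Z : ℝ} {r : ℕ} (hZ : 0 ≤ Z) (hM0 : M 0 = 0)
    (hM1 : M 1 ≤ Z) (hI : ∀ l, 0 ≤ I l)
    (h : ∀ m, 1 ≤ m → m < r → ∀ t : ℝ, 0 < t →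
      M (m + 1) ≤ M (m - 1) + t⁻¹ * (16 * M m + 4 * Z) + t * I m) :
    ∀ m ≤ r, M m ≤ 3 * Z + 128 * ∑ l ∈ Finset.Ico 1 r, √((r : ℝ) * l) * I l := by
  obtain ⟨p, hp, hmax⟩ := Finset.exists_max_image (Finset.range (r + 1)) M ⟨0, by simp⟩
  have hP : ∀ m ≤ r, M m ≤ M p := fun m hm => hmax m (by simp; omega)
  have hP0 : 0 ≤ M p := hM0 ▸ hP 0 (Nat.zero_le r)
  have hrec : ∀ m, 1 ≤ m → m < r → M (m + 1) ≤ M (m - 1) +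
      (4⁻¹ * (M p + Z) * ((√(r : ℝ))⁻¹ * (√(m : ℝ))⁻¹) + 64 * (√((r : ℝ) * m) * I m)) := by
    intro m hm hmr
    have h1 : 0 < √((r : ℝ) * m) := by
      apply Real.sqrt_pos.mpr
      have : 0 < r := by omega
      positivity
    have h2 := h m hm hmr (64 * √((r : ℝ) * m)) (by positivity)
    have h3 : (64 * √((r : ℝ) * m))⁻¹ * (16 * M m + 4 * Z) ≤
        4⁻¹ * (M p + Z) * ((√(r : ℝ))⁻¹ * (√(m : ℝ))⁻¹) := by
      rw [← mul_inv, ← Real.sqrt_mul (Nat.cast_nonneg r), mul_inv]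
      have h4 := hP m hmr.le
      have h5 := inv_pos.mpr h1
      nlinarith
    linarith
  have hsum : ∀ m ≤ r, M m ≤ Z + ∑ l ∈ Finset.Ico 1 m,
      (4⁻¹ * (M p + Z) * ((√(r : ℝ))⁻¹ * (√(l : ℝ))⁻¹) + 64 * (√((r : ℝ) * l) * I l)) := by
    have hnn : ∀ l : ℕ, 0 ≤
        4⁻¹ * (M p + Z) * ((√(r : ℝ))⁻¹ * (√(l : ℝ))⁻¹) + 64 * (√((r : ℝ) * l) * I l) := by
      intro l
      have := hI l
      positivity
    intro m
    induction m using Nat.strong_induction_on with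
    | _ m ih =>
      intro hm
      rcases m with _ | _ | m
      · simpa [hM0] using hZ
      · simpa using hM1
      · have h1 := hrec (m + 1) (by omega) (by omega)
        have h2 := ih m (by omega) (by omega)
        rw [Finset.sum_Ico_succ_top (by omega)]
        have h3 : ∑ l ∈ Finset.Ico 1 m, (4⁻¹ * (M p + Z) * ((√(r : ℝ))⁻¹ * (√(l : ℝ))⁻¹)
              + 64 * (√((r : ℝ) * l) * I l)) ≤
            ∑ l ∈ Finset.Ico 1 (m + 1), (4⁻¹ * (M p + Z) * ((√(r : ℝ))⁻¹ * (√(l : ℝ))⁻¹)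
              + 64 * (√((r : ℝ) * l) * I l)) :=
          Finset.sum_le_sum_of_subset_of_nonneg
            (Finset.Ico_subset_Ico_right (by omega)) fun l _ _ => hnn l
        simp only [Nat.add_sub_cancel] at h1
        linarith
  have hpr : p ≤ r := by simpa [Nat.lt_succ_iff] using hp
  have h1 := hsum p hpr
  have h2 : ∑ l ∈ Finset.Ico 1 p,
      (4⁻¹ * (M p + Z) * ((√(r : ℝ))⁻¹ * (√(l : ℝ))⁻¹) + 64 * (√((r : ℝ) * l) * I l)) ≤
      2⁻¹ * (M p + Z) + 64 * ∑ l ∈ Finset.Ico 1 r, √((r : ℝ) * l) * I l := by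
    rw [Finset.sum_add_distrib, ← Finset.mul_sum, ← Finset.mul_sum, ← Finset.mul_sum]
    have h3 : ∑ l ∈ Finset.Ico 1 p, (√(l : ℝ))⁻¹ ≤ 2 * √(r : ℝ) :=
      (Finset.sum_le_sum_of_subset_of_nonneg
        (Finset.Ico_subset_Ico_right (by omega)) fun l _ _ => by positivity).trans
        (sum_inv_sqrt_le r)
    have h4 : ∑ l ∈ Finset.Ico 1 p, √((r : ℝ) * l) * I l ≤
        ∑ l ∈ Finset.Ico 1 r, √((r : ℝ) * l) * I l :=
      Finset.sum_le_sum_of_subset_of_nonneg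
        (Finset.Ico_subset_Ico_right hpr) fun l _ _ => mul_nonneg (Real.sqrt_nonneg _) (hI l)
    have h5 : (√(r : ℝ))⁻¹ * ∑ l ∈ Finset.Ico 1 p, (√(l : ℝ))⁻¹ ≤ 2 := by
      rcases (Real.sqrt_nonneg (r : ℝ)).eq_or_lt with h0 | h0
      · rw [← h0]; simp
      · rw [inv_mul_le_iff₀ h0]; linarith
    nlinarith
  intro m hm
  have := hP m hm
  linarith

theorem sum_sqrt_dyadic_le (l K : ℕ) :
    ∑ k ∈ Finset.range K, (if l < 2 ^ k then √((l : ℝ) / 2 ^ k) else 0) ≤ 4 := by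
  suffices H : ∑ k ∈ Finset.range K, (if l < 2 ^ k then √((l : ℝ) / 2 ^ k) else 0) ≤
      if l < 2 ^ K then 4 - 4 * √((l : ℝ) / 2 ^ K) else 0 by
    refine H.trans ?_
    split_ifs
    · linarith [Real.sqrt_nonneg ((l : ℝ) / 2 ^ K)]
    · norm_num
  induction K with
  | zero =>
    simp only [Finset.range_zero, Finset.sum_empty]
    split_ifs with h
    · have : l = 0 := by simpa using h
      simp [this]
    · rfl
  | succ K ih =>
    rw [Finset.sum_range_succ]
    have hpow : 2 ^ (K + 1) = 2 * 2 ^ K := by ring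
    have hle : ∀ j, l < 2 ^ j → √((l : ℝ) / 2 ^ j) ≤ 1 := by
      intro j hj
      rw [Real.sqrt_le_one, div_le_one (by positivity)]
      exact_mod_cast hj.le
    by_cases h : l < 2 ^ K
    · have h' : l < 2 ^ (K + 1) := by omega
      rw [if_pos h] at ih ⊢
      rw [if_pos h']
      have h1 : √((l : ℝ) / 2 ^ (K + 1)) ≤ 3 / 4 * √((l : ℝ) / 2 ^ K) := by
        rw [show (3 / 4 : ℝ) = √(9 / 16) by
          rw [show (9 / 16 : ℝ) = (3 / 4) ^ 2 by norm_num, Real.sqrt_sq (by norm_num)],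
          ← Real.sqrt_mul (by norm_num)]
        apply Real.sqrt_le_sqrt
        have : (l : ℝ) / 2 ^ (K + 1) = 1 / 2 * ((l : ℝ) / 2 ^ K) := by rw [pow_succ]; field_simp
        have : 0 ≤ (l : ℝ) / 2 ^ K := by positivity
        linarith
      linarith
    · rw [if_neg h] at ih ⊢
      split_ifs with h'
      · linarith [hle _ h']
      · linarith

theorem sum_dyadic_le {I : ℕ → ℝ} (hI : ∀ l, 0 ≤ I l) {n K : ℕ} (hK : ∀ k < K, 2 ^ k ≤ n) :
    ∑ k ∈ Finset.range K,
        (∑ l ∈ Finset.Ico (1 : ℕ) (2 ^ k), √(((2 ^ k : ℕ) : ℝ) * l) * I l) / 2 ^ k ≤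
      4 * ∑ l ∈ Finset.Ico 1 n, I l := by
  have h1 : ∀ k ∈ Finset.range K,
      (∑ l ∈ Finset.Ico (1 : ℕ) (2 ^ k), √(((2 ^ k : ℕ) : ℝ) * l) * I l) / 2 ^ k =
      ∑ l ∈ Finset.Ico 1 n, (if l < 2 ^ k then √((l : ℝ) / 2 ^ k) else 0) * I l := by
    intro k hk
    have hkn := hK k (Finset.mem_range.mp hk)
    have hsub : Finset.Ico (1 : ℕ) (2 ^ k) ⊆ Finset.Ico 1 n := Finset.Ico_subset_Ico_right hkn
    rw [← Finset.sum_subset hsub]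
    · rw [Finset.sum_div]
      refine Finset.sum_congr rfl fun l hl => ?_
      rw [if_pos (Finset.mem_Ico.mp hl).2]
      push_cast
      have h2 : (l : ℝ) / 2 ^ k = (2 ^ k * l) / (2 ^ k) ^ 2 := by field_simp
      rw [h2, Real.sqrt_div (by positivity), Real.sqrt_sq (by positivity)]
      ring
    · intro l hl hl'
      have h3 := Finset.mem_Ico.mp hl
      have : ¬ l < 2 ^ k := fun h => hl' (Finset.mem_Ico.mpr ⟨h3.1, h⟩)
      simp [this]
  rw [Finset.sum_congr rfl h1, Finset.sum_comm, Finset.mul_sum]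
  refine Finset.sum_le_sum fun l _ => ?_
  rw [← Finset.sum_mul]
  exact mul_le_mul_of_nonneg_right (sum_sqrt_dyadic_le l K) (hI l)

section Moment

variable {G L : Type*} [Group G] [Fintype L] [Nonempty L] (φ : L → G)

/-- The sum of the entropies of the letters at a time and at the mirror image of that time. -/
noncomputable def symmEntropy (n l : ℕ) : ℝ :=
  bridgeEntropy φ l (n - 1 - l) + bridgeEntropy φ (n - l) (n - 1 - (n - l))

theorem symmEntropy_nonneg (n l : ℕ) : 0 ≤ symmEntropy φ n l :=
  add_nonneg (bridgeEntropy_nonneg φ _ _) (bridgeEntropy_nonneg φ _ _)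

theorem sum_symmEntropy_le (n : ℕ) :
    ∑ l ∈ Finset.Ico 1 n, symmEntropy φ n l ≤
      2 * (walkCount φ n 1 * (n * Real.log (Fintype.card L) - Real.log (walkCount φ n 1))) := by
  have h1 : ∑ l ∈ Finset.Ico 1 n, bridgeEntropy φ l (n - 1 - l) ≤
      ∑ l ∈ Finset.range n, bridgeEntropy φ l (n - 1 - l) := by
    rw [Finset.range_eq_Ico]
    exact Finset.sum_le_sum_of_subset_of_nonneg (Finset.Ico_subset_Ico_left zero_le_one)
      fun _ _ _ => bridgeEntropy_nonneg φ _ _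
  have h2 : ∑ l ∈ Finset.Ico 1 n, bridgeEntropy φ (n - l) (n - 1 - (n - l)) =
      ∑ l ∈ Finset.Ico 1 n, bridgeEntropy φ l (n - 1 - l) := by
    refine Finset.sum_bij' (fun l _ => n - l) (fun l _ => n - l) ?_ ?_ ?_ ?_ ?_
    all_goals
      intro l hl
      have := Finset.mem_Ico.mp hl
    · exact Finset.mem_Ico.mpr (by omega)
    · exact Finset.mem_Ico.mpr (by omega)
    · omega
    · omega
    · rfl
  simp only [symmEntropy]
  rw [Finset.sum_add_distrib, h2, ← sum_bridgeEntropy]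
  linarith

/-- A bound on the second moment of the displacement of a random closed word after `m ≤ r`
steps. -/
theorem bridgeSum_sq_le {len : G → ℝ} (h0 : ∀ x, 0 ≤ len x) (h1 : len 1 = 0)
    (hlen : ∀ x l, |len (x * φ l) - len x| ≤ 1)
    (ι : L ≃ L) (hι : ∀ l, φ (ι l) = (φ l)⁻¹) {n r : ℕ} (hr : 1 ≤ r) (hrn : r ≤ n) :
    ∀ m ≤ r, bridgeSum φ m (n - m) (fun x => len x ^ 2) ≤
      3 * walkCount φ n 1 + 128 * ∑ l ∈ Finset.Ico 1 r, √((r : ℝ) * l) * symmEntropy φ n l := by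
  refine le_of_two_step_recursion (walkCount_nonneg φ n 1) ?_ ?_ (symmEntropy_nonneg φ n) ?_
  · simp [bridgeSum, walkSum, h1]
  · have h2 : walkCount φ n 1 = bridgeSum φ 1 (n - 1) fun _ => 1 := by
      rw [bridgeSum_one, show 1 + (n - 1) = n by omega]
    rw [h2, show (1 : ℕ) = 0 + 1 from rfl, bridgeSum_succ, bridgeSum_succ]
    simp only [walkSum, pow_zero, Module.End.one_apply, one_mul]
    refine Finset.sum_le_sum fun l _ => ?_
    have h3 := abs_le.mp (hlen 1 l)
    rw [one_mul, h1] at h3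
    have h4 := h0 (φ l)
    have h5 : len (φ l) ^ 2 ≤ 1 := by nlinarith
    exact mul_le_of_le_one_left (walkCount_nonneg φ _ _) h5
  · intro m hm hmr t ht
    exact bridgeSum_sq_le_add φ h0 hlen ι hι hm (hmr.trans_le hrn) ht

/-- The second moments of the displacement of a random closed word at all dyadic scales,
normalised diffusively, add up to `O(log n)`. -/
theorem exists_dyadic_moment_bound
    (ι : L ≃ L) (hι : ∀ l, φ (ι l) = (φ l)⁻¹) (l₀ : L) (hl₀ : φ l₀ = 1)
    (hG : PolyGrowth (Set.range fun l => (φ l)⁻¹))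
    {len : G → ℝ} (h0 : ∀ x, 0 ≤ len x) (h1 : len 1 = 0)
    (hlen : ∀ x l, |len (x * φ l) - len x| ≤ 1) :
    ∃ c : ℝ, 0 ≤ c ∧ ∀ n K : ℕ, 2 ≤ n → (∀ k < K, 2 ^ k ≤ n) → ∃ B : ℕ → ℝ,
      (∀ k < K, ∀ m ≤ 2 ^ k,
        bridgeSum φ m (n - m) (fun x => len x ^ 2) ≤ B k * walkCount φ n 1) ∧
      ∑ k ∈ Finset.range K, B k / 2 ^ k ≤ c * Real.log n := by
  obtain ⟨C, D, hC, hret⟩ := card_pow_le_walkCount φ ι hι l₀ hl₀ hG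
  have hC1 : (1 : ℝ) ≤ C := by exact_mod_cast hC
  have hlC := Real.log_nonneg hC1
  have hl2 : 1 / 2 ≤ Real.log 2 := by linarith [Real.log_two_gt_d9]
  refine ⟨12 + 1024 * (2 * Real.log C + 2 * D), by positivity, fun n K hn hK => ?_⟩
  have hN : (0 : ℝ) < Fintype.card L := by exact_mod_cast Fintype.card_pos
  have hn0 : (2 : ℝ) ≤ n := by exact_mod_cast hn
  have hln : 1 / 2 ≤ Real.log n := hl2.trans (Real.log_le_log two_pos hn0)
  have hret := hret n
  set Z := walkCount φ n 1 with hZdef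
  have hpos : (0 : ℝ) < C * ((n : ℝ) + 1) ^ D := by positivity
  have hZ : 0 < Z := by
    have : 0 < C * ((n : ℝ) + 1) ^ D * Z := lt_of_lt_of_le (by positivity) hret
    exact pos_of_mul_pos_right this hpos.le
  have hent : n * Real.log (Fintype.card L) - Real.log Z ≤
      (2 * Real.log C + 2 * D) * Real.log n := by
    have h2 := Real.log_le_log (by positivity) hret
    rw [Real.log_pow, Real.log_mul hpos.ne' hZ.ne', Real.log_mul (by positivity) (by positivity),
      Real.log_pow] at h2
    have h3 : Real.log ((n : ℝ) + 1) ≤ 2 * Real.log n := by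
      rw [show 2 * Real.log n = ((2 : ℕ) : ℝ) * Real.log n by norm_num, ← Real.log_pow]
      exact Real.log_le_log (by positivity) (by nlinarith)
    have h4 : (D : ℝ) * Real.log ((n : ℝ) + 1) ≤ D * (2 * Real.log n) := by gcongr
    nlinarith
  refine ⟨fun k => 3 + 128 * ((∑ l ∈ Finset.Ico (1 : ℕ) (2 ^ k),
    √(((2 ^ k : ℕ) : ℝ) * l) * symmEntropy φ n l) / Z), fun k hk m hm => ?_, ?_⟩
  · refine (bridgeSum_sq_le φ h0 h1 hlen ι hι Nat.one_le_two_pow (hK k hk) m hm).trans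
      (le_of_eq ?_)
    field_simp
    rfl
  · have h2 : ∑ k ∈ Finset.range K, (3 : ℝ) / 2 ^ k ≤ 6 := by
      have : ∀ K : ℕ, ∑ k ∈ Finset.range K, (3 : ℝ) / 2 ^ k = 6 - 6 / 2 ^ K := by
        intro K
        induction K with
        | zero => norm_num
        | succ K ih => rw [Finset.sum_range_succ, ih, pow_succ]; field_simp; ring
      rw [this]
      have : (0 : ℝ) ≤ 6 / 2 ^ K := by positivity
      linarith
    have h3 := sum_dyadic_le (symmEntropy_nonneg φ n) hK
    have h4 := sum_symmEntropy_le φ n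
    have h5 : ∑ k ∈ Finset.range K, (3 + 128 * ((∑ l ∈ Finset.Ico (1 : ℕ) (2 ^ k),
          √(((2 ^ k : ℕ) : ℝ) * l) * symmEntropy φ n l) / Z)) / 2 ^ k =
        ∑ k ∈ Finset.range K, (3 : ℝ) / 2 ^ k + 128 * (∑ k ∈ Finset.range K,
          (∑ l ∈ Finset.Ico (1 : ℕ) (2 ^ k),
            √(((2 ^ k : ℕ) : ℝ) * l) * symmEntropy φ n l) / 2 ^ k) / Z := by
      rw [Finset.mul_sum, Finset.sum_div, ← Finset.sum_add_distrib]
      refine Finset.sum_congr rfl fun k _ => ?_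
      field_simp
    rw [h5]
    have h6 : 128 * (∑ k ∈ Finset.range K, (∑ l ∈ Finset.Ico (1 : ℕ) (2 ^ k),
            √(((2 ^ k : ℕ) : ℝ) * l) * symmEntropy φ n l) / 2 ^ k) / Z ≤
        1024 * ((2 * Real.log C + 2 * D) * Real.log n) := by
      rw [div_le_iff₀ hZ]
      have h7 := mul_le_mul_of_nonneg_left hent hZ.le
      linarith
    linarith

end Moment

/-- The sum of `Φ` over all words of length `n`. -/
def wordSum {L : Type*} [Fintype L] : ℕ → (List L → ℝ) → ℝ
  | 0, Φ => Φ []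
  | n + 1, Φ => ∑ l, wordSum n fun u => Φ (l :: u)

section Word

variable {G L : Type*} [Group G] [Fintype L] (φ : L → G)

theorem sum_ofFn_eq_wordSum (n : ℕ) (Φ : List L → ℝ) :
    ∑ w : Fin n → L, Φ (List.ofFn w) = wordSum n Φ := by
  induction n generalizing Φ with
  | zero => simp [wordSum]
  | succ n ih =>
    rw [← (Fin.consEquiv fun _ => L).sum_comp, Fintype.sum_prod_type, wordSum]
    refine Finset.sum_congr rfl fun l _ => ?_
    rw [← ih]
    simp [Fin.consEquiv]

theorem wordSum_congr {n : ℕ} {Φ Ψ : List L → ℝ} (h : ∀ u, u.length = n → Φ u = Ψ u) :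
    wordSum n Φ = wordSum n Ψ := by
  rw [← sum_ofFn_eq_wordSum, ← sum_ofFn_eq_wordSum]
  exact Finset.sum_congr rfl fun w _ => h _ (by simp)

theorem wordSum_mul_left (n : ℕ) (c : ℝ) (Φ : List L → ℝ) :
    wordSum n (fun u => c * Φ u) = c * wordSum n Φ := by
  rw [← sum_ofFn_eq_wordSum, ← sum_ofFn_eq_wordSum, Finset.mul_sum]

theorem wordSum_comm (a b : ℕ) (Φ : List L → List L → ℝ) :
    wordSum a (fun u => wordSum b fun v => Φ u v) =
      wordSum b fun v => wordSum a fun u => Φ u v := by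
  simp only [← sum_ofFn_eq_wordSum]
  exact Finset.sum_comm

theorem wordSum_add (a b : ℕ) (Φ : List L → ℝ) :
    wordSum (a + b) Φ = wordSum a fun u => wordSum b fun v => Φ (u ++ v) := by
  induction a generalizing Φ with
  | zero => simp [wordSum]
  | succ a ih =>
    rw [show a + 1 + b = a + b + 1 by ring, wordSum, wordSum]
    exact Finset.sum_congr rfl fun l _ => ih _

theorem wordSum_prod (n : ℕ) (f : G → ℝ) (g : G) :
    wordSum n (fun u => f (g * (u.map φ).prod)) = (walkOp φ ^ n) f g := by
  induction n generalizing g with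
  | zero => simp [wordSum]
  | succ n ih =>
    rw [wordSum, pow_succ', Module.End.mul_apply, walkOp_apply]
    refine Finset.sum_congr rfl fun l _ => ?_
    simp only [List.map_cons, List.prod_cons, ← mul_assoc]
    exact ih _

theorem sum_walkCount_mul_left (c : ℕ) (g : G) :
    ∑ l, walkCount φ c (φ l * g) = walkCount φ (c + 1) g := by
  induction c generalizing g with
  | zero =>
    rw [walkCount_succ]
    refine Finset.sum_congr rfl fun l _ => ?_
    have h : φ l * g ∈ ({1} : Set G) ↔ g * φ l ∈ ({1} : Set G) := mul_eq_one_comm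
    simp only [walkCount_zero]
    by_cases h' : g * φ l ∈ ({1} : Set G)
    · rw [Set.indicator_of_mem h', Set.indicator_of_mem (h.mpr h')]
      rfl
    · rw [Set.indicator_of_notMem h', Set.indicator_of_notMem (mt h.mp h')]
  | succ c ih =>
    have h : ∀ l, walkCount φ (c + 1) (φ l * g) = ∑ l', walkCount φ c (φ l * (g * φ l')) := by
      intro l
      simp only [walkCount_succ, mul_assoc]
    rw [Finset.sum_congr rfl fun l _ => h l, Finset.sum_comm, walkCount_succ]
    exact Finset.sum_congr rfl fun l _ => ih _

theorem wordSum_walkCount_mul (a c : ℕ) (g : G) :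
    wordSum a (fun u => walkCount φ c ((u.map φ).prod * g)) = walkCount φ (a + c) g := by
  induction a generalizing g with
  | zero => simp [wordSum]
  | succ a ih =>
    have h : wordSum (a + 1) (fun u => walkCount φ c ((u.map φ).prod * g)) =
        ∑ l, wordSum a (fun u => walkCount φ c ((u.map φ).prod * (φ l * g))) := by
      rw [wordSum_add]
      simp only [wordSum, List.map_append, List.prod_append, List.map_cons, List.map_nil,
        List.prod_cons, List.prod_nil, mul_one, mul_assoc]
      simp only [← sum_ofFn_eq_wordSum]
      exact Finset.sum_comm
    rw [h]
    simp only [ih]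
    rw [sum_walkCount_mul_left, show a + c + 1 = a + 1 + c by ring]

/-- Summing a function of the increment between two times over all closed words gives a bridge
sum: the count of closed words is invariant under cyclic permutations. -/
theorem wordSum_increment {n a b : ℕ} (hab : a ≤ b) (hbn : b ≤ n) (f : G → ℝ) :
    wordSum n (fun w => ({1} : Set G).indicator 1 (w.map φ).prod *
        f (((w.take a).map φ).prod⁻¹ * ((w.take b).map φ).prod)) =
      bridgeSum φ (b - a) (n - (b - a)) f := by
  obtain ⟨m, rfl⟩ := Nat.exists_eq_add_of_le hab
  obtain ⟨c, rfl⟩ := Nat.exists_eq_add_of_le hbn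
  rw [wordSum_add, wordSum_add, show a + m - a = m by omega,
    show a + m + c - m = a + c by omega]
  have h1 : ∀ u : List L, u.length = a → (wordSum m fun v => wordSum c fun z =>
        ({1} : Set G).indicator 1 ((u ++ v ++ z).map φ).prod *
          f ((((u ++ v ++ z).take a).map φ).prod⁻¹ *
            (((u ++ v ++ z).take (a + m)).map φ).prod)) =
      wordSum m fun v => f (v.map φ).prod *
        walkCount φ c ((u.map φ).prod * (v.map φ).prod) := by
    intro u hu
    refine wordSum_congr fun v hv => ?_
    rw [walkCount, ← wordSum_prod, ← wordSum_mul_left]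
    refine wordSum_congr fun z _ => ?_
    have h2 : (u ++ v ++ z).take a = u := by
      rw [List.append_assoc]; exact List.take_left' hu
    have h3 : (u ++ v ++ z).take (a + m) = u ++ v :=
      List.take_left' (by simp [hu, hv])
    rw [h2, h3]
    simp only [List.map_append, List.prod_append, inv_mul_cancel_left]
    ring
  rw [wordSum_congr h1, wordSum_comm]
  simp only [wordSum_mul_left, wordSum_walkCount_mul]
  have h4 := wordSum_prod φ m (fun x => f x * walkCount φ (a + c) x) 1
  simp only [one_mul] at h4
  exact h4

end Word

theorem fillingArea_le_length (r : Fin s → FreeGroup (Fin d)) (l : List (FreeGroup (Fin d)))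
    (hl : ∀ x ∈ l, ∃ (g : FreeGroup (Fin d)) (a : Fin s) (ε : Bool),
      x = g⁻¹ * r a ^ (if ε then (1 : ℤ) else -1) * g) :
    fillingArea r l.prod ≤ l.length := by
  refine Nat.sInf_le ?_
  choose g a ε h using fun i : Fin l.length => hl (l.get i) (List.get_mem l i)
  refine ⟨g, a, ε, ?_⟩
  simp only [← h]
  rw [List.ofFn_get]

theorem exists_list_length_eq_fillingArea (r : Fin s → FreeGroup (Fin d))
    {w : FreeGroup (Fin d)} (hw : w ∈ relSubgroup r) :
    ∃ l : List (FreeGroup (Fin d)), l.length = fillingArea r w ∧ l.prod = w ∧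
      ∀ x ∈ l, ∃ (g : FreeGroup (Fin d)) (a : Fin s) (ε : Bool),
        x = g⁻¹ * r a ^ (if ε then (1 : ℤ) else -1) * g := by
  have hne : { k | ∃ (g : Fin k → FreeGroup (Fin d)) (a : Fin k → Fin s) (ε : Fin k → Bool),
      w = (List.ofFn (fun i => (g i)⁻¹ * (r (a i)) ^ (if ε i then (1 : ℤ) else -1) * g i)).prod
      }.Nonempty := by
    rw [relSubgroup, Subgroup.normalClosure, ← Subgroup.mem_toSubmonoid,
      Subgroup.closure_toSubmonoid] at hw
    obtain ⟨l, hl, hprod⟩ := Submonoid.exists_list_of_mem_closure hw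
    have hl' : ∀ x ∈ l, ∃ (g : FreeGroup (Fin d)) (a : Fin s) (ε : Bool),
        x = g⁻¹ * r a ^ (if ε then (1 : ℤ) else -1) * g := by
      intro x hx
      rcases hl x hx with h | h
      · obtain ⟨_, ⟨a, rfl⟩, h⟩ := Group.mem_conjugatesOfSet_iff.mp h
        obtain ⟨g, rfl⟩ := isConj_iff.mp h
        exact ⟨g⁻¹, a, true, by simp⟩
      · obtain ⟨_, ⟨a, rfl⟩, h⟩ := Group.mem_conjugatesOfSet_iff.mp h
        obtain ⟨g, h⟩ := isConj_iff.mp h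
        refine ⟨g⁻¹, a, false, ?_⟩
        rw [← inv_inj, ← h]
        simp [mul_assoc]
    choose g a ε h using fun i : Fin l.length => hl' (l.get i) (List.get_mem l i)
    refine ⟨l.length, g, a, ε, ?_⟩
    simp only [← h]
    rw [List.ofFn_get, hprod]
  obtain ⟨g, a, ε, h⟩ := Nat.sInf_mem hne
  refine ⟨_, List.length_ofFn, h.symm, fun x hx => ?_⟩
  obtain ⟨i, rfl⟩ := List.mem_ofFn.mp hx
  exact ⟨g i, a i, ε i, rfl⟩

theorem fillingArea_mul_le (r : Fin s → FreeGroup (Fin d)) {v w : FreeGroup (Fin d)}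
    (hv : v ∈ relSubgroup r) (hw : w ∈ relSubgroup r) :
    fillingArea r (v * w) ≤ fillingArea r v + fillingArea r w := by
  obtain ⟨l, hl, rfl, hl'⟩ := exists_list_length_eq_fillingArea r hv
  obtain ⟨k, hk, rfl, hk'⟩ := exists_list_length_eq_fillingArea r hw
  rw [← hl, ← hk, ← List.prod_append, ← List.length_append]
  refine fillingArea_le_length r _ fun x hx => ?_
  rcases List.mem_append.mp hx with h | h
  exacts [hl' x h, hk' x h]

theorem fillingArea_conj_le (r : Fin s → FreeGroup (Fin d)) {w : FreeGroup (Fin d)}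
    (hw : w ∈ relSubgroup r) (g : FreeGroup (Fin d)) :
    fillingArea r (g * w * g⁻¹) ≤ fillingArea r w := by
  obtain ⟨l, hl, rfl, hl'⟩ := exists_list_length_eq_fillingArea r hw
  rw [← hl, ← MulAut.conj_apply, map_list_prod, ← List.length_map (MulAut.conj g) (as := l)]
  refine fillingArea_le_length r _ fun x hx => ?_
  obtain ⟨y, hy, rfl⟩ := List.mem_map.mp hx
  obtain ⟨h, a, ε, rfl⟩ := hl' y hy
  exact ⟨h * g⁻¹, a, ε, by simp [mul_assoc]⟩

theorem fillingArea_le_dehn (r : Fin s → FreeGroup (Fin d)) {w : FreeGroup (Fin d)}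
    (hw : w ∈ relSubgroup r) {n : ℕ} (hn : w.norm ≤ n) : fillingArea r w ≤ dehn r n := by
  refine le_csSup (Set.Finite.bddAbove ?_) ⟨w, hw, hn, rfl⟩
  refine ((List.finite_length_le (Fin d × Bool) n).image
    fun l => fillingArea r (FreeGroup.mk l)).subset ?_
  rintro _ ⟨v, _, hv, rfl⟩
  exact ⟨v.toWord, hv, by simp only [FreeGroup.mk_toWord]⟩

theorem exists_fillingArea_le (r : Fin s → FreeGroup (Fin d))
    (hdehn : ∃ C : ℝ, ∃ N₀ : ℕ, ∀ n : ℕ, N₀ ≤ n → (dehn r n : ℝ) ≤ C * (n : ℝ) ^ 2) :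
    ∃ c : ℝ, 0 ≤ c ∧ ∀ w ∈ relSubgroup r, (fillingArea r w : ℝ) ≤ c * ((w.norm : ℝ) ^ 2 + 1) := by
  obtain ⟨C, N₀, h⟩ := hdehn
  refine ⟨|C| * (2 * ((N₀ : ℝ) ^ 2 + 1)), by positivity, fun w hw => ?_⟩
  have h1 : (fillingArea r w : ℝ) ≤ dehn r (w.norm + N₀) := by
    exact_mod_cast fillingArea_le_dehn r hw (Nat.le_add_right _ _)
  have h2 := h _ (Nat.le_add_left N₀ w.norm)
  have h3 : (((w.norm + N₀ : ℕ) : ℝ)) ^ 2 ≤ 2 * ((N₀ : ℝ) ^ 2 + 1) * ((w.norm : ℝ) ^ 2 + 1) := by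
    push_cast
    nlinarith [sq_nonneg ((w.norm : ℝ) - N₀), sq_nonneg ((w.norm : ℝ) * N₀)]
  calc (fillingArea r w : ℝ) ≤ C * ((w.norm + N₀ : ℕ) : ℝ) ^ 2 := h1.trans h2
    _ ≤ |C| * ((w.norm + N₀ : ℕ) : ℝ) ^ 2 := by gcongr; exact le_abs_self C
    _ ≤ |C| * (2 * ((N₀ : ℝ) ^ 2 + 1) * ((w.norm : ℝ) ^ 2 + 1)) := by gcongr
    _ = _ := by ring

/-- A choice of shortest representatives of the elements of a quotient of a free group. -/
theorem exists_min_norm_section {α : Type*} [DecidableEq α] (R : Subgroup (FreeGroup α))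
    [R.Normal] :
    ∃ γ : FreeGroup α ⧸ R → FreeGroup α, (∀ g, (γ g : FreeGroup α ⧸ R) = g) ∧
      ∀ w : FreeGroup α, (γ w).norm ≤ w.norm := by
  have h : ∀ g : FreeGroup α ⧸ R, ∃ v : FreeGroup α, (v : FreeGroup α ⧸ R) = g ∧
      ∀ w : FreeGroup α, (w : FreeGroup α ⧸ R) = g → v.norm ≤ w.norm := by
    intro g
    obtain ⟨v, hv, hmin⟩ := (measure (FreeGroup.norm (α := α))).wf.has_min
      {w : FreeGroup α | (w : FreeGroup α ⧸ R) = g} (QuotientGroup.mk_surjective g)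
    exact ⟨v, hv, fun w hw => not_lt.mp (hmin w hw)⟩
  choose γ h1 h2 using h
  exact ⟨γ, h1, fun w => h2 _ w rfl⟩

theorem norm_letterVal_le (l : Letter d) : (letterVal l).norm ≤ 1 := by
  rcases l with _ | ⟨i, _ | _⟩ <;> simp [letterVal]

theorem partialProd_succ {n : ℕ} (w : Fin n → Letter d) (t : ℕ) :
    (partialProd w t)⁻¹ * partialProd w (t + 1) = 1 ∨
      ∃ l, (partialProd w t)⁻¹ * partialProd w (t + 1) = letterVal l := by
  unfold partialProd
  rw [List.take_add_one]
  rcases (List.ofFn w)[t]? with _ | l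
  · simp
  · right; exact ⟨l, by simp⟩

section Filling

variable (r : Fin s → FreeGroup (Fin d)) {c : ℝ}
  {γ : FreeGroup (Fin d) ⧸ relSubgroup r → FreeGroup (Fin d)}

theorem mul_inv_section_mem (hγ : ∀ g, (γ g : FreeGroup (Fin d) ⧸ relSubgroup r) = g)
    (w : FreeGroup (Fin d)) : w * (γ w)⁻¹ ∈ relSubgroup r := by
  rw [← QuotientGroup.eq_one_iff, QuotientGroup.mk_mul, QuotientGroup.mk_inv, hγ, mul_inv_cancel]

theorem fillingArea_mul_section_le (hc : 0 ≤ c)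
    (hfill : ∀ w ∈ relSubgroup r, (fillingArea r w : ℝ) ≤ c * ((w.norm : ℝ) ^ 2 + 1))
    (hγ : ∀ g, (γ g : FreeGroup (Fin d) ⧸ relSubgroup r) = g)
    (hmin : ∀ w : FreeGroup (Fin d), (γ w).norm ≤ w.norm) (u v : FreeGroup (Fin d)) :
    (fillingArea r (u * v * (γ ↑(u * v))⁻¹) : ℝ) ≤
      fillingArea r (u * (γ u)⁻¹) + fillingArea r (v * (γ v)⁻¹) +
        c * (8 * ((γ u).norm : ℝ) ^ 2 + 8 * ((γ v).norm : ℝ) ^ 2 + 1) := by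
  have h1 : u * v * (γ ↑(u * v))⁻¹ =
      u * (γ u)⁻¹ * (γ u * (v * (γ v)⁻¹) * (γ u)⁻¹) * (γ u * γ v * (γ ↑(u * v))⁻¹) := by
    group
  have hu := mul_inv_section_mem r hγ u
  have hv := mul_inv_section_mem r hγ v
  have hv' := Subgroup.Normal.conj_mem inferInstance _ hv (γ u)
  have heq : ((γ u * γ v : FreeGroup (Fin d)) : FreeGroup (Fin d) ⧸ relSubgroup r) =
      ↑(u * v) := by
    rw [QuotientGroup.mk_mul, hγ, hγ, QuotientGroup.mk_mul]
  have ht : γ u * γ v * (γ ↑(u * v))⁻¹ ∈ relSubgroup r := by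
    rw [← heq]
    exact mul_inv_section_mem r hγ _
  have h2 := fillingArea_mul_le r (mul_mem hu hv') ht
  have h3 := fillingArea_mul_le r hu hv'
  have h4 := fillingArea_conj_le r hv (γ u)
  rw [← h1] at h2
  have h5 := hfill _ ht
  have h6 : (γ u * γ v * (γ ↑(u * v))⁻¹).norm ≤ 2 * ((γ u).norm + (γ v).norm) := by
    have h7 := FreeGroup.norm_mul_le (γ u * γ v) (γ ↑(u * v))⁻¹
    have h8 := FreeGroup.norm_mul_le (γ u) (γ v)
    have h9 := hmin (γ u * γ v)
    rw [heq] at h9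
    rw [FreeGroup.norm_inv_eq] at h7
    omega
  have h10 : ((γ u * γ v * (γ ↑(u * v))⁻¹).norm : ℝ) ^ 2 ≤
      8 * ((γ u).norm : ℝ) ^ 2 + 8 * ((γ v).norm : ℝ) ^ 2 := by
    have h11 : ((γ u * γ v * (γ ↑(u * v))⁻¹).norm : ℝ) ≤ 2 * ((γ u).norm + (γ v).norm) := by
      exact_mod_cast h6
    have h12 := pow_le_pow_left₀ (Nat.cast_nonneg _) h11 2
    nlinarith [sq_nonneg (((γ u).norm : ℝ) - (γ v).norm)]
  have h13 : (fillingArea r (u * v * (γ ↑(u * v))⁻¹) : ℝ) ≤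
      fillingArea r (u * (γ u)⁻¹) + fillingArea r (v * (γ v)⁻¹) +
        fillingArea r (γ u * γ v * (γ ↑(u * v))⁻¹) := by
    exact_mod_cast h2.trans (by omega)
  have h14 : c * (((γ u * γ v * (γ ↑(u * v))⁻¹).norm : ℝ) ^ 2 + 1) ≤
      c * (8 * ((γ u).norm : ℝ) ^ 2 + 8 * ((γ v).norm : ℝ) ^ 2 + 1) := by
    gcongr
  linarith

/-- The total filling area of a family of loops is controlled by the second moments of their
dyadic increments. -/
theorem sum_fillingArea_dyadic_le (hc : 0 ≤ c)
    (hfill : ∀ w ∈ relSubgroup r, (fillingArea r w : ℝ) ≤ c * ((w.norm : ℝ) ^ 2 + 1))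
    (hγ : ∀ g, (γ g : FreeGroup (Fin d) ⧸ relSubgroup r) = g)
    (hmin : ∀ w : FreeGroup (Fin d), (γ w).norm ≤ w.norm)
    {ι : Type*} (W : Finset ι) (X : ι → ℕ → FreeGroup (Fin d))
    (hX : ∀ w t, ((X w t)⁻¹ * X w (t + 1)).norm ≤ 1) (B : ℕ → ℝ) (K : ℕ)
    (hB : ∀ k < K, ∀ t, ∑ w ∈ W, ((γ ↑((X w t)⁻¹ * X w (t + 2 ^ k))).norm : ℝ) ^ 2 ≤
      B k * W.card) :
    ∀ k ≤ K, ∀ t, ∑ w ∈ W, (fillingArea r ((X w t)⁻¹ * X w (t + 2 ^ k) *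
        (γ ↑((X w t)⁻¹ * X w (t + 2 ^ k)))⁻¹) : ℝ) ≤
      c * W.card * (2 ^ k * (5 + ∑ i ∈ Finset.range k, (8 * B i + 1) / 2 ^ i)) := by
  intro k
  induction k with
  | zero =>
    intro _ t
    have h1 : ∀ w ∈ W, (fillingArea r ((X w t)⁻¹ * X w (t + 2 ^ 0) *
        (γ ↑((X w t)⁻¹ * X w (t + 2 ^ 0)))⁻¹) : ℝ) ≤ c * 5 := by
      intro w _
      refine (hfill _ (mul_inv_section_mem r hγ _)).trans ?_
      have h2 : ((X w t)⁻¹ * X w (t + 2 ^ 0) *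
          (γ ↑((X w t)⁻¹ * X w (t + 2 ^ 0)))⁻¹).norm ≤ 2 := by
        refine (FreeGroup.norm_mul_le _ _).trans ?_
        rw [FreeGroup.norm_inv_eq]
        have h3 := hX w t
        have h4 := hmin ((X w t)⁻¹ * X w (t + 1))
        rw [pow_zero]
        omega
      have h3 : (((X w t)⁻¹ * X w (t + 2 ^ 0) *
          (γ ↑((X w t)⁻¹ * X w (t + 2 ^ 0)))⁻¹).norm : ℝ) ≤ 2 := by exact_mod_cast h2
      have h4 := pow_le_pow_left₀ (Nat.cast_nonneg _) h3 2
      gcongr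
      linarith
    refine (Finset.sum_le_sum h1).trans (le_of_eq ?_)
    simp
    ring
  | succ k ih =>
    intro hk t
    have h1 : ∀ w ∈ W, _ := fun w _ => fillingArea_mul_section_le r hc hfill hγ hmin
      ((X w t)⁻¹ * X w (t + 2 ^ k)) ((X w (t + 2 ^ k))⁻¹ * X w (t + 2 ^ k + 2 ^ k))
    have h2 : ∀ w, (X w t)⁻¹ * X w (t + 2 ^ k) * ((X w (t + 2 ^ k))⁻¹ * X w (t + 2 ^ k + 2 ^ k)) =
        (X w t)⁻¹ * X w (t + 2 ^ (k + 1)) := by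
      intro w
      rw [pow_succ, mul_two, ← add_assoc]
      group
    simp only [h2] at h1
    refine (Finset.sum_le_sum h1).trans ?_
    have h3 := ih (by omega) t
    have h4 := ih (by omega) (t + 2 ^ k)
    have h5 := mul_le_mul_of_nonneg_left (hB k (by omega) t) hc
    have h6 := mul_le_mul_of_nonneg_left (hB k (by omega) (t + 2 ^ k)) hc
    rw [Finset.sum_add_distrib, Finset.sum_add_distrib, ← Finset.mul_sum, Finset.sum_add_distrib,
      Finset.sum_add_distrib, ← Finset.mul_sum, ← Finset.mul_sum, Finset.sum_const, nsmul_eq_mul,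
      Finset.sum_range_succ]
    have h7 : c * (W.card : ℝ) * (2 ^ (k + 1) *
        (5 + (∑ i ∈ Finset.range k, (8 * B i + 1) / 2 ^ i + (8 * B k + 1) / 2 ^ k))) =
        2 * (c * W.card * (2 ^ k * (5 + ∑ i ∈ Finset.range k, (8 * B i + 1) / 2 ^ i))) +
          c * W.card * (16 * B k + 2) := by
      rw [pow_succ]
      field_simp
      ring
    rw [h7]
    have h8 : 0 ≤ c * (W.card : ℝ) := by positivity
    linarith

end Filling

theorem mk_partialProd (r : Fin s → FreeGroup (Fin d)) {n : ℕ} (w : Fin n → Letter d) (t : ℕ) :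
    (partialProd w t : FreeGroup (Fin d) ⧸ relSubgroup r) =
      (((List.ofFn w).take (min t n)).map fun l =>
        (letterVal l : FreeGroup (Fin d) ⧸ relSubgroup r)).prod := by
  have h : (List.ofFn w).take t = (List.ofFn w).take (min t n) := by
    rw [List.take_eq_take_iff, List.length_ofFn, min_assoc, min_self]
  rw [partialProd, h, ← QuotientGroup.mk'_apply, map_list_prod, List.map_map]
  rfl

/-- Summing a function of the increment of a closed word between two times. -/
theorem sum_closedWords_increment (r : Fin s → FreeGroup (Fin d)) (n : ℕ) {t u : ℕ} (htu : t ≤ u)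
    (f : FreeGroup (Fin d) ⧸ relSubgroup r → ℝ) :
    ∑ w ∈ closedWords r n, f ↑((partialProd w t)⁻¹ * partialProd w u) =
      bridgeSum (fun l : Letter d => (letterVal l : FreeGroup (Fin d) ⧸ relSubgroup r))
        (min u n - min t n) (n - (min u n - min t n)) f := by
  rw [← wordSum_increment _ (min_le_min_right n htu) (min_le_right u n), ← sum_ofFn_eq_wordSum,
    closedWords, Finset.sum_filter]
  refine Finset.sum_congr rfl fun w _ => ?_
  rw [QuotientGroup.mk_mul, QuotientGroup.mk_inv, mk_partialProd, mk_partialProd,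
    ← QuotientGroup.eq_one_iff, mk_partialProd, min_self,
    List.take_of_length_le (by rw [List.length_ofFn])]
  split_ifs with h
  · rw [h]; simp
  · rw [Set.indicator_of_notMem (by simpa using h), zero_mul]

theorem card_closedWords (r : Fin s → FreeGroup (Fin d)) (n : ℕ) :
    ((closedWords r n).card : ℝ) =
      walkCount (fun l : Letter d => (letterVal l : FreeGroup (Fin d) ⧸ relSubgroup r)) n 1 := by
  have h := sum_closedWords_increment r n le_rfl (t := 0) fun _ => 1
  rw [bridgeSum_one] at h
  simpa using h

theorem norm_partialProd_step_le {n : ℕ} (w : Fin n → Letter d) (t : ℕ) :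
    ((partialProd w t)⁻¹ * partialProd w (t + 1)).norm ≤ 1 := by
  rcases partialProd_succ w t with h | ⟨l, h⟩
  · simp [h]
  · rw [h]; exact norm_letterVal_le l

theorem avgDehn_nlogn_of_dehn_quadratic {d s : ℕ} (r : Fin s → FreeGroup (Fin d))
    (hnilp : Group.IsNilpotent (FreeGroup (Fin d) ⧸ relSubgroup r))
    (hdehn : ∃ C : ℝ, ∃ N₀ : ℕ, ∀ n : ℕ, N₀ ≤ n → (dehn r n : ℝ) ≤ C * (n : ℝ) ^ 2) :
    ∃ C' : ℝ, ∃ N₁ : ℕ, ∀ n : ℕ, N₁ ≤ n →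
      avgDehn r n ≤ C' * (n : ℝ) * Real.log n := by
  obtain ⟨c, hc, hfill⟩ := exists_fillingArea_le r hdehn
  obtain ⟨γ, hγ, hmin⟩ := exists_min_norm_section (relSubgroup r)
  let φ : Letter d → FreeGroup (Fin d) ⧸ relSubgroup r := fun l => letterVal l
  let ι : Letter d ≃ Letter d :=
    Equiv.optionCongr ((Equiv.refl (Fin d)).prodCongr Equiv.boolNot)
  have hι' : ∀ l, letterVal (ι l) = (letterVal l)⁻¹ := by
    rintro (_ | ⟨i, _ | _⟩) <;> simp [ι, letterVal]
  have hι : ∀ l, φ (ι l) = (φ l)⁻¹ := fun l => by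
    simp only [φ, hι', QuotientGroup.mk_inv]
  have hγ1 : γ 1 = 1 := by
    have h := hmin 1
    rw [FreeGroup.norm_one, Nat.le_zero, FreeGroup.norm_eq_zero] at h
    exact h
  have hlen : ∀ x l, ((γ (x * φ l)).norm : ℝ) ≤ (γ x).norm + 1 := by
    intro x l
    have h1 := hmin (γ x * letterVal l)
    rw [QuotientGroup.mk_mul, hγ] at h1
    have h2 := FreeGroup.norm_mul_le (γ x) (letterVal l)
    have h3 := norm_letterVal_le l
    exact_mod_cast h1.trans (h2.trans (by omega))
  have hlen' : ∀ x l, |((γ (x * φ l)).norm : ℝ) - (γ x).norm| ≤ 1 := by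
    intro x l
    have h1 := hlen x l
    have h2 := hlen (x * φ l) (ι l)
    rw [hι, mul_inv_cancel_right] at h2
    rw [abs_le]
    constructor <;> linarith
  obtain ⟨c', hc', hmom⟩ := exists_dyadic_moment_bound φ ι hι none rfl
    (polyGrowth_of_isNilpotent (Set.finite_range _)) (len := fun x => ((γ x).norm : ℝ))
    (fun _ => Nat.cast_nonneg _) (by simp [hγ1]) hlen'
  refine ⟨c * (28 + 16 * c'), 2, fun n hn => ?_⟩
  obtain ⟨B, hB, hBsum⟩ := hmom n (Nat.clog 2 n) hn
    fun k hk => (Nat.lt_clog_iff_pow_lt one_lt_two).mp hk |>.le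
  set K := Nat.clog 2 n with hK
  have hnK : n ≤ 2 ^ K := Nat.le_pow_clog one_lt_two n
  have hKn : 2 ^ K ≤ 2 * n := by
    have hK0 : 0 < K := Nat.clog_pos one_lt_two hn
    have h1 := Nat.pow_pred_clog_lt_self one_lt_two hn
    rw [← hK] at h1
    have h2 : 2 ^ K = 2 * 2 ^ K.pred := by
      rw [← pow_succ', Nat.pred_eq_sub_one, Nat.sub_add_cancel hK0]
    omega
  have hB' : ∀ k < K, ∀ t, ∑ w ∈ closedWords r n,
      ((γ ↑((partialProd w t)⁻¹ * partialProd w (t + 2 ^ k))).norm : ℝ) ^ 2 ≤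
        B k * (closedWords r n).card := by
    intro k hk t
    rw [sum_closedWords_increment r n (Nat.le_add_right t _) fun x => ((γ x).norm : ℝ) ^ 2,
      card_closedWords]
    refine hB k hk _ ?_
    generalize 2 ^ k = q
    omega
  have hsum := sum_fillingArea_dyadic_le r hc hfill hγ hmin (closedWords r n) partialProd
    norm_partialProd_step_le B K hB' K le_rfl 0
  have hend : ∀ w ∈ closedWords r n, (fillingArea r ((partialProd w 0)⁻¹ *
      partialProd w (0 + 2 ^ K) * (γ ↑((partialProd w 0)⁻¹ * partialProd w (0 + 2 ^ K)))⁻¹) : ℝ) =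
        fillingArea r (partialProd w n) := by
    intro w hw
    have h1 : partialProd w (0 + 2 ^ K) = partialProd w n := by
      simp only [partialProd]
      rw [List.take_of_length_le (by simpa using hnK), List.take_of_length_le (by simp)]
    have h2 : partialProd w 0 = 1 := by simp [partialProd]
    have h3 : ((partialProd w n : FreeGroup (Fin d)) : FreeGroup (Fin d) ⧸ relSubgroup r) = 1 := by
      classical
      rw [closedWords, Finset.mem_filter] at hw
      exact (QuotientGroup.eq_one_iff _).mpr hw.2
    rw [h1, h2, inv_one, one_mul, h3, hγ1, inv_one, mul_one]
  rw [Finset.sum_congr rfl hend] at hsum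
  have hgeom : ∑ i ∈ Finset.range K, (8 * B i + 1) / 2 ^ i ≤ 8 * (c' * Real.log n) + 2 := by
    have h1 : ∀ i ∈ Finset.range K, (8 * B i + 1) / 2 ^ i =
        8 * (B i / 2 ^ i) + (1 / 2) ^ i := by
      intro i _
      rw [div_pow, one_pow]
      ring
    rw [Finset.sum_congr rfl h1, Finset.sum_add_distrib, ← Finset.mul_sum]
    have h2 := sum_geometric_two_le K
    linarith
  have hlog : 1 / 2 ≤ Real.log n := by
    have h1 : Real.log 2 ≤ Real.log n := Real.log_le_log two_pos (by exact_mod_cast hn)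
    linarith [Real.log_two_gt_d9]
  have hKn' : (2 : ℝ) ^ K ≤ 2 * n := by exact_mod_cast hKn
  rw [avgDehn]
  refine div_le_of_le_mul₀ (Nat.cast_nonneg _) (by positivity) (hsum.trans ?_)
  calc c * (closedWords r n).card * (2 ^ K * (5 + ∑ i ∈ Finset.range K, (8 * B i + 1) / 2 ^ i))
      ≤ c * (closedWords r n).card * (2 ^ K * (5 + (8 * (c' * Real.log n) + 2))) := by gcongr
    _ ≤ c * (closedWords r n).card * (2 * n * (5 + (8 * (c' * Real.log n) + 2))) := by
        have : 0 ≤ c' * Real.log n := by positivity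
        gcongr
    _ ≤ c * (closedWords r n).card * (2 * n * ((14 + 8 * c') * Real.log n)) := by
        gcongr
        linarith
    _ = c * (28 + 16 * c') * n * Real.log n * (closedWords r n).card := by ring

end AvgDehnPaper
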